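/- Let F be a field of characteristic p > 0, K/F a purely inseparable extension of exponent one with [K:F] = p^e, δ a derivation on K with Const(δ) = F, and f ∈ K[t;δ] of degree m with 2 ≤ m < p^e such that B = Nuc_r(S_f) is a central simple algebra of degree m over F. Then the following are equivalent: f is irreducible in K[t;δ]; B is a division algebra; S_f is a division algebra. -/

import Mathlib

open scoped TensorProduct

/-! ## A framework for differential polynomial rings `K[t;δ]` and Petit algebras `S_f`. -/

/-- A derivation on a field `K`: an additive map satisfying the Leibniz rule. -/
structure Der (K : Type) [Field K] where
  toFun : K → K
  map_add' : ∀ a b : K, toFun (a + b) = toFun a + toFun b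
  leibniz' : ∀ a b : K, toFun (a * b) = a * toFun b + toFun a * b

/-- `F` (given as a subfield of `K` via `algebraMap F K`) is precisely the field of
constants `Const(δ) = {a ∈ K | δ(a) = 0}` of the derivation `δ`. -/
def Der.HasConstants {K : Type} [Field K] (δ : Der K) (F : Type) [Field F]
    [Algebra F K] : Prop :=
  ∀ a : K, δ.toFun a = 0 ↔ ∃ c : F, algebraMap F K c = a

/-- The map `V_p(b) = b^p + δ^{p-1}(b)`. -/
def Der.Vp {K : Type} [Field K] (δ : Der K) (p : ℕ) (b : K) : K :=
  b ^ p + δ.toFun^[p - 1] b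

/-- The `e`-fold iterate `V_{p^e}` of `V_p`. -/
def Der.VpIter {K : Type} [Field K] (δ : Der K) (p e : ℕ) : K → K :=
  (δ.Vp p)^[e]

/-- A realization of the differential polynomial ring `R = K[t;δ]`: a ring `R`
together with an embedding `i : K → R` and an element `t` satisfying the
twist relation `t·a = a·t + δ(a)`, such that every element of `R` is *uniquely*
a left `K`-linear combination of the powers `t^n` (witnessed by the coefficient
function `coeff`), and such that `R` admits a right division algorithm. -/
structure DiffPolyRing (K : Type) [Field K] (δ : Der K) (R : Type) [Ring R] where
  i : K →+* R
  t : R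
  coeff : R → (ℕ →₀ K)
  t_mul : ∀ a : K, t * i a = i a * t + i (δ.toFun a)
  repr' : ∀ x : R, x = (coeff x).sum fun n a => i a * t ^ n
  coeff_unique : ∀ (x : R) (c : ℕ →₀ K), x = (c.sum fun n a => i a * t ^ n) → c = coeff x
  rightDiv : ∀ f x : R, f ≠ 0 → ∃! r : R,
    (∃ q : R, x = q * f + r) ∧ (coeff r).support.max < (coeff f).support.max

namespace DiffPolyRing

variable {K : Type} [Field K] {δ : Der K} {R : Type} [Ring R]

/-- The degree of a differential polynomial, with `deg 0 = ⊥`. -/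
def deg (D : DiffPolyRing K δ R) (x : R) : WithBot ℕ := (D.coeff x).support.max

lemma coeff_zero (D : DiffPolyRing K δ R) : D.coeff 0 = 0 :=
  (D.coeff_unique 0 0 (by simp)).symm

lemma deg_zero (D : DiffPolyRing K δ R) : D.deg 0 = ⊥ := by
  simp [deg, D.coeff_zero]

lemma coeff_add (D : DiffPolyRing K δ R) (x y : R) :
    D.coeff (x + y) = D.coeff x + D.coeff y := by
  refine (D.coeff_unique _ _ ?_).symm
  rw [Finsupp.sum_add_index' (by simp) (by intro n a b; rw [map_add, add_mul])]
  conv_lhs => rw [D.repr' x, D.repr' y]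

lemma coeff_neg (D : DiffPolyRing K δ R) (x : R) : D.coeff (-x) = -D.coeff x := by
  have h := D.coeff_add (-x) x
  rw [neg_add_cancel, D.coeff_zero] at h
  exact eq_neg_of_add_eq_zero_left h.symm

lemma deg_neg (D : DiffPolyRing K δ R) (x : R) : D.deg (-x) = D.deg x := by
  simp [deg, D.coeff_neg]

lemma deg_add_lt (D : DiffPolyRing K δ R) {x y : R} {n : WithBot ℕ}
    (hx : D.deg x < n) (hy : D.deg y < n) : D.deg (x + y) < n := by
  have hsub : (D.coeff (x + y)).support ⊆ (D.coeff x).support ∪ (D.coeff y).support := by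
    rw [D.coeff_add]; exact Finsupp.support_add
  calc D.deg (x + y) ≤ ((D.coeff x).support ∪ (D.coeff y).support).max :=
        Finset.max_mono hsub
    _ = max (D.deg x) (D.deg y) := Finset.max_union
    _ < n := max_lt hx hy

lemma coeff_smul (D : DiffPolyRing K δ R) (c : K) (x : R) :
    D.coeff (D.i c * x) = c • D.coeff x := by
  refine (D.coeff_unique _ _ ?_).symm
  rw [Finsupp.sum_smul_index (by simp)]
  conv_lhs => rw [D.repr' x, Finsupp.mul_sum]
  exact Finsupp.sum_congr fun n _ => by rw [← mul_assoc, ← map_mul]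

lemma deg_i_mul_lt (D : DiffPolyRing K δ R) (c : K) {x : R} {n : WithBot ℕ}
    (hx : D.deg x < n) : D.deg (D.i c * x) < n := by
  have hsub : (D.coeff (D.i c * x)).support ⊆ (D.coeff x).support := by
    rw [D.coeff_smul]; exact Finsupp.support_smul
  exact lt_of_le_of_lt (Finset.max_mono hsub) hx

/-- The additive subgroup of `R` consisting of the differential polynomials of
degree `< m`; this is the underlying set of the Petit algebra `S_f` for `deg f = m`. -/
def res (D : DiffPolyRing K δ R) (m : ℕ) : AddSubgroup R where
  carrier := {x | D.deg x < (m : WithBot ℕ)}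
  add_mem' hx hy := D.deg_add_lt hx hy
  zero_mem' := by
    show D.deg 0 < (m : WithBot ℕ)
    rw [D.deg_zero]
    exact bot_lt_iff_ne_bot.2 (by simp)
  neg_mem' {x} hx := by
    show D.deg (-x) < (m : WithBot ℕ)
    rw [D.deg_neg]; exact hx

/-- The underlying set `{g ∈ K[t;δ] | deg g < m}` of the Petit algebra `S_f`
(for `f` of degree `m`), viewed as a subset of `R = K[t;δ]`. -/
def SfSet (D : DiffPolyRing K δ R) (m : ℕ) : Set R := {x | D.deg x < (m : WithBot ℕ)}

/-- The underlying `F`-vector space of the Petit algebra `S_f`, for `f` of degree `m`. -/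
abbrev Rlt (D : DiffPolyRing K δ R) (m : ℕ) : Type := ↥(D.res m)

instance instSMul {F : Type} [Field F] [Algebra F K] (D : DiffPolyRing K δ R) (m : ℕ) :
    SMul F (D.Rlt m) :=
  ⟨fun c x => ⟨D.i (algebraMap F K c) * (x : R), D.deg_i_mul_lt _ x.2⟩⟩

lemma smul_coe {F : Type} [Field F] [Algebra F K] (D : DiffPolyRing K δ R) (m : ℕ)
    (c : F) (x : D.Rlt m) : ((c • x : D.Rlt m) : R) = D.i (algebraMap F K c) * (x : R) := rfl

/-- The `F`-vector space structure of the Petit algebra (where `F ⊆ K` is the field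
of constants): `c • x = i(c)·x`. -/
instance instModule {F : Type} [Field F] [Algebra F K] (D : DiffPolyRing K δ R) (m : ℕ) :
    Module F (D.Rlt m) where
  one_smul x := Subtype.ext <| by rw [smul_coe]; simp
  mul_smul a b x := Subtype.ext <| by rw [smul_coe, smul_coe, smul_coe]; simp [mul_assoc]
  smul_zero a := Subtype.ext <| by rw [smul_coe]; simp
  smul_add a x y := Subtype.ext <| by
    rw [smul_coe]
    push_cast
    rw [smul_coe, smul_coe, mul_add]
  add_smul a b x := Subtype.ext <| by
    push_cast
    rw [smul_coe, smul_coe, smul_coe]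
    simp [add_mul]
  zero_smul x := Subtype.ext <| by rw [smul_coe]; simp

open Classical in
/-- The remainder `mod_r f` of right division by `f`. -/
noncomputable def modr (D : DiffPolyRing K δ R) (f x : R) : R :=
  if h : ∃! r : R, (∃ q : R, x = q * f + r) ∧
      (D.coeff r).support.max < (D.coeff f).support.max then h.choose else 0

/-- The multiplication of the Petit algebra `S_f`: `g ∘ h = g·h mod_r f`. -/
noncomputable def pmul (D : DiffPolyRing K δ R) (f x y : R) : R := D.modr f (x * y)

/-- The left nucleus of the Petit algebra `S_f`, as a subset of `R`. -/
def nucl (D : DiffPolyRing K δ R) (f : R) (m : ℕ) : Set R :=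
  {x ∈ D.SfSet m | ∀ y ∈ D.SfSet m, ∀ z ∈ D.SfSet m,
    D.pmul f (D.pmul f x y) z = D.pmul f x (D.pmul f y z)}

/-- The middle nucleus of the Petit algebra `S_f`, as a subset of `R`. -/
def nucm (D : DiffPolyRing K δ R) (f : R) (m : ℕ) : Set R :=
  {x ∈ D.SfSet m | ∀ y ∈ D.SfSet m, ∀ z ∈ D.SfSet m,
    D.pmul f (D.pmul f y x) z = D.pmul f y (D.pmul f x z)}

/-- The right nucleus of the Petit algebra `S_f`, as a subset of `R`. -/
def nucr (D : DiffPolyRing K δ R) (f : R) (m : ℕ) : Set R :=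
  {x ∈ D.SfSet m | ∀ y ∈ D.SfSet m, ∀ z ∈ D.SfSet m,
    D.pmul f (D.pmul f y z) x = D.pmul f y (D.pmul f z x)}

/-- The nucleus of the Petit algebra `S_f`, as a subset of `R`. -/
def nuc (D : DiffPolyRing K δ R) (f : R) (m : ℕ) : Set R :=
  D.nucl f m ∩ D.nucm f m ∩ D.nucr f m

/-- `f` is irreducible in `K[t;δ]`: it is not a unit and admits no factorization
into two factors of strictly smaller degree. -/
def Irred (D : DiffPolyRing K δ R) (f : R) : Prop :=
  ¬IsUnit f ∧ ¬∃ g h : R, f = g * h ∧ D.deg g < D.deg f ∧ D.deg h < D.deg f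

/-- The Petit algebra `S_f` is a division algebra: it is nonzero, and all left and
right multiplications by nonzero elements are bijective. -/
def IsDivisionPetit (D : DiffPolyRing K δ R) (f : R) (m : ℕ) : Prop :=
  (∃ x ∈ D.SfSet m, x ≠ 0) ∧ ∀ a ∈ D.SfSet m, a ≠ 0 →
    Set.BijOn (fun x => D.pmul f a x) (D.SfSet m) (D.SfSet m) ∧
    Set.BijOn (fun x => D.pmul f x a) (D.SfSet m) (D.SfSet m)

/-- The unital `F`-algebra `B` realizes the right nucleus of the Petit algebra `S_f`:
there is a bijection `B ≃ Nuc_r(S_f)` preserving addition, multiplication and the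
`F`-algebra structure. -/
def RightNucPresents (F : Type) [Field F] [Algebra F K] (D : DiffPolyRing K δ R)
    (f : R) (m : ℕ) (B : Type) [Ring B] [Algebra F B] : Prop :=
  ∃ φ : B ≃ (D.nucr f m),
    (∀ x y : B, ((φ (x + y) : R)) = (φ x : R) + (φ y : R)) ∧
    (∀ x y : B, ((φ (x * y) : R)) = D.pmul f (φ x : R) (φ y : R)) ∧
    (∀ c : F, ((φ (algebraMap F B c) : R)) = D.i (algebraMap F K c))

/-- A subset `S` of an `F`-vector space has dimension `d`: it contains `d` linearly
independent vectors whose span contains `S`. -/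
def SetDim (F : Type) [Field F] {M : Type} [AddCommGroup M] [Module F M]
    (S : Set M) (d : ℕ) : Prop :=
  ∃ s : Finset M, ↑s ⊆ S ∧ s.card = d ∧
    LinearIndependent F (fun x : (s : Set M) => (x : M)) ∧
    S ⊆ (Submodule.span F (s : Set M) : Set M)

/-- `f ∈ K[t;δ]` of degree `m` is an `A`-polynomial (over the field of constants `F`),
via Amitsur's characterization: the right nucleus of `S_f` has dimension `m²` over `F`. -/
def IsAPoly (F : Type) [Field F] [Algebra F K] (D : DiffPolyRing K δ R)
    (f : R) (m : ℕ) : Prop :=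
  SetDim F {x : D.Rlt m | (x : R) ∈ D.nucr f m} (m ^ 2)

/-- `f ∈ R = K[t;δ]` is bounded: there is `f* ≠ 0` such that `Rf* = f*R` is the
largest two-sided ideal of `R` contained in `Rf`. -/
def IsBounded (D : DiffPolyRing K δ R) (f : R) : Prop :=
  ∃ fs : R, fs ≠ 0 ∧
    {x : R | ∃ r, x = r * fs} = {x : R | ∃ r, x = fs * r} ∧
    (∀ x : R, (∃ r, x = r * fs) → ∃ r, x = r * f) ∧
    ∀ J : Set R, (0 : R) ∈ J → (∀ a ∈ J, ∀ b ∈ J, a + b ∈ J) →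
      (∀ r : R, ∀ a ∈ J, r * a ∈ J ∧ a * r ∈ J) →
      (∀ x ∈ J, ∃ r, x = r * f) → ∀ x ∈ J, ∃ r, x = r * fs

/-- `S_f` is a free right module of rank `n` over its right nucleus. -/
def FreeRankOverNucr (D : DiffPolyRing K δ R) (f : R) (m n : ℕ) : Prop :=
  ∃ b : Fin n → R, (∀ j, b j ∈ D.SfSet m) ∧
    ∀ x ∈ D.SfSet m, ∃! c : Fin n → (D.nucr f m),
      x = ∑ j, D.pmul f (b j) ((c j : R))

/-- The Petit algebra `S_f` is unital with unit `1 ∈ K[t;δ]`. -/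
def PetitUnital (D : DiffPolyRing K δ R) (f : R) (m : ℕ) : Prop :=
  (1 : R) ∈ D.SfSet m ∧ ∀ x ∈ D.SfSet m, D.pmul f 1 x = x ∧ D.pmul f x 1 = x

end DiffPolyRing

/-! ### Helpers for the characteristic `p` theory -/

/-- `B` is a `p`-algebra over `F`: a (finite-dimensional) central simple `F`-algebra
whose index is a power of `p`, i.e. `B ≅ Mat_k(Dv)` for a central division algebra `Dv`
of degree a power of `p`. -/
def IsPAlgebra (p : ℕ) (F B : Type) [Field F] [Ring B] [Algebra F B] : Prop :=
  Algebra.IsCentral F B ∧ IsSimpleRing B ∧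
    ∃ (Dv : Type) (_ : DivisionRing Dv) (_ : Algebra F Dv) (k n : ℕ),
      Nonempty (B ≃ₐ[F] Matrix (Fin k) (Fin k) Dv) ∧ Module.finrank F Dv = (p ^ n) ^ 2

/-- `δ` is an algebraic derivation of degree `p^e` with minimum polynomial
`g(t) = t^{p^e} + c₁ t^{p^{e-1}} + ⋯ + c_e t` (coefficients in the constant field `F`):
`g(δ) = 0` as an additive map on `K`, and no `p`-polynomial of smaller degree
annihilates `δ`. -/
def Der.IsMinPoly {K : Type} [Field K] (δ : Der K) {F : Type} [Field F] [Algebra F K]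
    (p e : ℕ) (c : Fin e → F) : Prop :=
  (∀ a : K, δ.toFun^[p ^ e] a
      + ∑ i : Fin e, algebraMap F K (c i) * δ.toFun^[p ^ (e - 1 - (i : ℕ))] a = 0) ∧
  ∀ e' : ℕ, e' < e → ∀ c' : Fin e' → F, ¬ ∀ a : K, δ.toFun^[p ^ e'] a
      + ∑ i : Fin e', algebraMap F K (c' i) * δ.toFun^[p ^ (e' - 1 - (i : ℕ))] a = 0

/-- The two-sided element `z = g(t) - d₀ = t^{p^e} + c₁ t^{p^{e-1}} + ⋯ + c_e t - d₀`
of `K[t;δ]`. -/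
def DiffPolyRing.gElt {K : Type} [Field K] {δ : Der K} {R : Type} [Ring R]
    (D : DiffPolyRing K δ R) {F : Type} [Field F] [Algebra F K]
    (p e : ℕ) (c : Fin e → F) (d₀ : F) : R :=
  D.t ^ p ^ e + ∑ i : Fin e, D.i (algebraMap F K (c i)) * D.t ^ p ^ (e - 1 - (i : ℕ))
    - D.i (algebraMap F K d₀)

namespace DiffPolyRing

variable {K : Type} [Field K] {δ : Der K} {R : Type} [Ring R]

/-! ### Coefficients and degrees -/

lemma mem_res_iff (D : DiffPolyRing K δ R) {n : ℕ} {x : R} :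
    x ∈ D.res n ↔ ∀ k, n ≤ k → D.coeff x k = 0 := by
  change (D.coeff x).support.max < (n : WithBot ℕ) ↔ _
  rw [Finset.max_eq_sup_withBot]
  refine (Finset.sup_lt_iff (a := (n : WithBot ℕ)) (WithBot.bot_lt_coe n)).trans ?_
  constructor
  · intro h k hk
    by_contra hne
    have hlt : k < n := WithBot.coe_lt_coe.1 (h k (by simpa using hne))
    omega
  · intro h k hk
    suffices k < n from WithBot.coe_lt_coe.2 this
    by_contra hlt
    exact Finsupp.mem_support_iff.1 hk (h k (by omega))

lemma res_mono (D : DiffPolyRing K δ R) {m n : ℕ} (h : m ≤ n) : D.res m ≤ D.res n :=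
  fun _ hx => D.mem_res_iff.2 fun k hk => D.mem_res_iff.1 hx k (h.trans hk)

lemma deg_eq_iff (D : DiffPolyRing K δ R) {n : ℕ} {x : R} :
    D.deg x = n ↔ x ∈ D.res (n + 1) ∧ D.coeff x n ≠ 0 := by
  constructor
  · intro h
    refine ⟨?_, Finsupp.mem_support_iff.1 (Finset.mem_of_max h)⟩
    change D.deg x < _
    rw [h]
    exact WithBot.coe_lt_coe.2 (Nat.lt_succ_self n)
  · rintro ⟨h, hn⟩
    refine le_antisymm ?_ (Finset.le_max (Finsupp.mem_support_iff.2 hn))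
    refine Finset.max_le fun k hk => ?_
    suffices k ≤ n from WithBot.coe_le_coe.2 this
    by_contra hlt
    exact (Finsupp.mem_support_iff.1 hk) (D.mem_res_iff.1 h k (by omega))

lemma eq_zero_of_coeff (D : DiffPolyRing K δ R) {x : R} (h : D.coeff x = 0) : x = 0 := by
  rw [D.repr' x, h, Finsupp.sum_zero_index]

lemma exists_deg_eq (D : DiffPolyRing K δ R) {x : R} (hx : x ≠ 0) : ∃ n : ℕ, D.deg x = n := by
  refine Finset.max_of_nonempty (Finsupp.support_nonempty_iff.2 fun h => hx ?_)
  exact D.eq_zero_of_coeff h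

lemma coeff_sum_monomial (D : DiffPolyRing K δ R) (c : ℕ →₀ K) :
    D.coeff (c.sum fun n a => D.i a * D.t ^ n) = c :=
  (D.coeff_unique _ c rfl).symm

lemma coeff_monomial (D : DiffPolyRing K δ R) (a : K) (n : ℕ) :
    D.coeff (D.i a * D.t ^ n) = Finsupp.single n a := by
  refine (D.coeff_unique _ _ ?_).symm
  rw [Finsupp.sum_single_index (by simp)]

lemma coeff_i (D : DiffPolyRing K δ R) (a : K) : D.coeff (D.i a) = Finsupp.single 0 a := by
  simpa using D.coeff_monomial a 0

lemma coeff_sub (D : DiffPolyRing K δ R) (x y : R) :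
    D.coeff (x - y) = D.coeff x - D.coeff y := by
  rw [sub_eq_add_neg, D.coeff_add, D.coeff_neg, sub_eq_add_neg]

lemma induction_monomial (D : DiffPolyRing K δ R) {P : R → Prop} (x : R) (zero : P 0)
    (add : ∀ x y, P x → P y → P (x + y)) (mono : ∀ a n, P (D.i a * D.t ^ n)) : P x := by
  rw [D.repr' x]
  exact Finset.sum_induction _ P add zero fun n _ => mono _ _

lemma coeff_mul_t_succ (D : DiffPolyRing K δ R) (x : R) (k : ℕ) :
    D.coeff (x * D.t) (k + 1) = D.coeff x k := by
  induction x using D.induction_monomial with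
  | zero => simp [D.coeff_zero]
  | add x y hx hy => rw [add_mul, D.coeff_add, D.coeff_add, Finsupp.add_apply, hx, hy,
      Finsupp.add_apply]
  | mono a n =>
    rw [mul_assoc, ← pow_succ, D.coeff_monomial, D.coeff_monomial]
    simp [Finsupp.single_apply]

lemma coeff_mul_t_zero (D : DiffPolyRing K δ R) (x : R) : D.coeff (x * D.t) 0 = 0 := by
  induction x using D.induction_monomial with
  | zero => simp [D.coeff_zero]
  | add x y hx hy => rw [add_mul, D.coeff_add, Finsupp.add_apply, hx, hy, add_zero]
  | mono a n =>
    rw [mul_assoc, ← pow_succ, D.coeff_monomial]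
    simp

end DiffPolyRing

lemma Der.map_zero {K : Type} [Field K] (δ : Der K) : δ.toFun 0 = 0 := by
  simpa using δ.map_add' 0 0

lemma Der.map_one {K : Type} [Field K] (δ : Der K) : δ.toFun 1 = 0 := by
  simpa using δ.leibniz' 1 1

namespace DiffPolyRing

variable {K : Type} [Field K] {δ : Der K} {R : Type} [Ring R]

lemma t_mul_monomial (D : DiffPolyRing K δ R) (a : K) (n : ℕ) :
    D.t * (D.i a * D.t ^ n) = D.i a * D.t ^ (n + 1) + D.i (δ.toFun a) * D.t ^ n := by
  rw [← mul_assoc, D.t_mul, add_mul, mul_assoc, ← pow_succ']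

lemma coeff_t_mul_succ (D : DiffPolyRing K δ R) (x : R) (k : ℕ) :
    D.coeff (D.t * x) (k + 1) = D.coeff x k + δ.toFun (D.coeff x (k + 1)) := by
  induction x using D.induction_monomial with
  | zero => simp [D.coeff_zero, δ.map_zero]
  | add x y hx hy =>
    rw [mul_add, D.coeff_add, D.coeff_add, Finsupp.add_apply, hx, hy, Finsupp.add_apply,
      Finsupp.add_apply, δ.map_add']
    ring
  | mono a n =>
    rw [D.t_mul_monomial, D.coeff_add, D.coeff_monomial, D.coeff_monomial, D.coeff_monomial]
    by_cases h : n = k + 1 <;> simp [Finsupp.single_apply, h, δ.map_zero]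

lemma coeff_t_mul_zero (D : DiffPolyRing K δ R) (x : R) :
    D.coeff (D.t * x) 0 = δ.toFun (D.coeff x 0) := by
  induction x using D.induction_monomial with
  | zero => simp [D.coeff_zero, δ.map_zero]
  | add x y hx hy =>
    rw [mul_add, D.coeff_add, D.coeff_add, Finsupp.add_apply, hx, hy, Finsupp.add_apply,
      δ.map_add']
  | mono a n =>
    rw [D.t_mul_monomial, D.coeff_add, D.coeff_monomial, D.coeff_monomial, D.coeff_monomial]
    by_cases h : n = 0 <;> simp [h, δ.map_zero]

lemma t_pow_mul_mem_res (D : DiffPolyRing K δ R) {n : ℕ} {y : R} (hy : y ∈ D.res (n + 1))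
    (j : ℕ) : D.t ^ j * y ∈ D.res (j + n + 1) ∧ D.coeff (D.t ^ j * y) (j + n) = D.coeff y n := by
  induction j with
  | zero => simpa using hy
  | succ j ih =>
    obtain ⟨h1, h2⟩ := ih
    rw [D.mem_res_iff] at h1 ⊢
    rw [pow_succ', mul_assoc, show j + 1 + n = (j + n) + 1 by ring]
    refine ⟨fun k hk => ?_, ?_⟩
    · obtain ⟨k, rfl⟩ : ∃ k', k = k' + 1 := ⟨k - 1, by omega⟩
      rw [D.coeff_t_mul_succ, h1 k (by omega), h1 (k + 1) (by omega), δ.map_zero, add_zero]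
    · rw [D.coeff_t_mul_succ, h2, h1 _ le_rfl, δ.map_zero, add_zero]

lemma coeff_mul (D : DiffPolyRing K δ R) (x y : R) (k : ℕ) :
    D.coeff (x * y) k = (D.coeff x).sum fun j a => a * D.coeff (D.t ^ j * y) k := by
  induction x using D.induction_monomial with
  | zero => simp [D.coeff_zero]
  | add x₁ x₂ h₁ h₂ =>
    rw [add_mul, D.coeff_add, D.coeff_add, Finsupp.add_apply, h₁, h₂,
      Finsupp.sum_add_index' (by simp) (by intros; ring)]
  | mono a n =>
    rw [mul_assoc, D.coeff_smul, D.coeff_monomial, Finsupp.sum_single_index (by simp)]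
    rfl

lemma mul_mem_res (D : DiffPolyRing K δ R) {j n : ℕ} {x y : R} (hx : x ∈ D.res (j + 1))
    (hy : y ∈ D.res (n + 1)) :
    x * y ∈ D.res (j + n + 1) ∧ D.coeff (x * y) (j + n) = D.coeff x j * D.coeff y n := by
  have hlow : ∀ k i, i + n < k → D.coeff (D.t ^ i * y) k = 0 := fun k i hk =>
    D.mem_res_iff.1 (D.t_pow_mul_mem_res hy i).1 k hk
  have hx' := D.mem_res_iff.1 hx
  refine ⟨D.mem_res_iff.2 fun k hk => ?_, ?_⟩
  · rw [D.coeff_mul]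
    refine Finset.sum_eq_zero fun i hi => ?_
    have : i < j + 1 := by
      by_contra h
      exact Finsupp.mem_support_iff.1 hi (hx' i (by omega))
    simp only [hlow k i (by omega), mul_zero]
  · rw [D.coeff_mul, Finsupp.sum, Finset.sum_eq_single j]
    · rw [(D.t_pow_mul_mem_res hy j).2]
    · intro i hi hij
      have : i < j + 1 := by
        by_contra h
        exact Finsupp.mem_support_iff.1 hi (hx' i (by omega))
      rw [hlow _ i (by omega), mul_zero]
    · intro h
      rw [Finsupp.notMem_support_iff.1 h, zero_mul]

lemma deg_mul (D : DiffPolyRing K δ R) {j n : ℕ} {x y : R} (hx : D.deg x = j)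
    (hy : D.deg y = n) : D.deg (x * y) = (j + n : ℕ) := by
  rw [D.deg_eq_iff] at hx hy ⊢
  obtain ⟨h1, h2⟩ := D.mul_mem_res hx.1 hy.1
  exact ⟨h1, h2 ▸ mul_ne_zero hx.2 hy.2⟩

lemma ne_zero_of_deg_eq (D : DiffPolyRing K δ R) {n : ℕ} {x : R} (hx : D.deg x = n) : x ≠ 0 := by
  rintro rfl
  rw [D.deg_zero] at hx
  exact WithBot.bot_ne_coe hx

lemma i_mem_res_one (D : DiffPolyRing K δ R) (a : K) : D.i a ∈ D.res 1 := by
  refine D.mem_res_iff.2 fun k hk => ?_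
  rw [D.coeff_i, Finsupp.single_apply, if_neg (by omega)]

lemma eq_i_of_mem_res_one (D : DiffPolyRing K δ R) {x : R} (hx : x ∈ D.res 1) :
    x = D.i (D.coeff x 0) := by
  refine sub_eq_zero.1 (D.eq_zero_of_coeff (Finsupp.ext fun k => ?_))
  rw [D.coeff_sub, D.coeff_i, Finsupp.sub_apply]
  rcases k with _ | k
  · simp
  · simp [D.mem_res_iff.1 hx (k + 1) (by omega)]

lemma mem_res_of_coeff_eq_zero (D : DiffPolyRing K δ R) {n : ℕ} {x : R}
    (hx : x ∈ D.res (n + 1)) (h : D.coeff x n = 0) : x ∈ D.res n := by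
  refine D.mem_res_iff.2 fun k hk => ?_
  rcases hk.eq_or_lt with rfl | hk
  · exact h
  · exact D.mem_res_iff.1 hx k hk

/-- A nonzero left ideal contains a monic element of minimal degree. -/
lemma exists_monic_minimal (D : DiffPolyRing K δ R) {J : Ideal R} (hJ : J ≠ ⊥) :
    ∃ g ∈ J, ∃ n : ℕ, D.deg g = n ∧ D.coeff g n = 1 ∧ ∀ x ∈ J, x ∈ D.res n → x = 0 := by
  classical
  obtain ⟨x, hxJ, hx⟩ := (Submodule.ne_bot_iff J).1 hJ
  have hex : ∃ n : ℕ, ∃ y ∈ J, D.deg y = n :=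
    (D.exists_deg_eq hx).imp fun n hn => ⟨x, hxJ, hn⟩
  obtain ⟨y, hyJ, hy⟩ := Nat.find_spec hex
  set n := Nat.find hex
  have hc := (D.deg_eq_iff.1 hy).2
  have hone : D.coeff (D.i (D.coeff y n)⁻¹ * y) n = 1 := by
    rw [D.coeff_smul, Finsupp.smul_apply, smul_eq_mul, inv_mul_cancel₀ hc]
  refine ⟨D.i (D.coeff y n)⁻¹ * y, J.mul_mem_left _ hyJ, n,
    D.deg_eq_iff.2 ⟨D.deg_i_mul_lt _ (D.deg_eq_iff.1 hy).1, ?_⟩, hone, fun z hzJ hz => ?_⟩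
  · rw [hone]
    exact one_ne_zero
  · by_contra hne
    obtain ⟨k, hk⟩ := D.exists_deg_eq hne
    have hkn : k < n := WithBot.coe_lt_coe.1 (hk ▸ hz : (k : WithBot ℕ) < n)
    exact Nat.find_min hex hkn ⟨z, hzJ, hk⟩

lemma exists_eq_mul_of_minimal (D : DiffPolyRing K δ R) {J : Ideal R} {g : R} (hg : g ∈ J)
    {n : ℕ} (hn : D.deg g = n) (hmin : ∀ x ∈ J, x ∈ D.res n → x = 0) {x : R} (hx : x ∈ J) :
    ∃ q, x = q * g := by
  obtain ⟨r, ⟨⟨q, hq⟩, hr⟩, -⟩ := D.rightDiv g x (D.ne_zero_of_deg_eq hn)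
  refine ⟨q, ?_⟩
  have hrJ : r ∈ J := by
    rw [show r = x - q * g by rw [hq]; abel]
    exact J.sub_mem hx (J.mul_mem_left _ hg)
  rw [hq, hmin r hrJ (show D.deg r < n from hn ▸ hr), add_zero]

/-- The monic generator of a two-sided ideal commutes with `K` and with `t`. -/
lemma commute_of_minimal (D : DiffPolyRing K δ R) {J : Ideal R}
    (hJ : ∀ x ∈ J, ∀ y, x * y ∈ J) {g : R} (hg : g ∈ J) {n : ℕ} (hn : D.deg g = n)
    (hone : D.coeff g n = 1) (hmin : ∀ x ∈ J, x ∈ D.res n → x = 0) (x : R) :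
    x * g = g * x := by
  have hgn := (D.deg_eq_iff.1 hn).1
  have hi : ∀ a, D.i a * g = g * D.i a := by
    intro a
    refine sub_eq_zero.1 (hmin _ (J.sub_mem (J.mul_mem_left _ hg) (hJ g hg _)) ?_)
    have h2 := D.mul_mem_res hgn (D.i_mem_res_one a)
    refine D.mem_res_of_coeff_eq_zero ((D.res _).sub_mem (D.deg_i_mul_lt _ hgn) h2.1) ?_
    rw [add_zero] at h2
    rw [D.coeff_sub, Finsupp.sub_apply, h2.2, hone, D.coeff_smul, D.coeff_i]
    simp [hone]
  have ht : D.t * g = g * D.t := by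
    refine sub_eq_zero.1 (hmin _ (J.sub_mem (J.mul_mem_left _ hg) (hJ g hg _)) ?_)
    have hgk := D.mem_res_iff.1 hgn
    refine D.mem_res_iff.2 fun k hk => ?_
    have hδ : δ.toFun (D.coeff g k) = 0 := by
      rcases hk.eq_or_lt with rfl | hk
      · rw [hone, δ.map_one]
      · rw [hgk k hk, δ.map_zero]
    rw [D.coeff_sub, Finsupp.sub_apply]
    rcases k with _ | k
    · rw [D.coeff_t_mul_zero, D.coeff_mul_t_zero, hδ, sub_zero]
    · rw [D.coeff_t_mul_succ, D.coeff_mul_t_succ, hδ, add_zero, sub_self]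
  induction x using D.induction_monomial with
  | zero => simp
  | add x y hx hy => rw [add_mul, mul_add, hx, hy]
  | mono a k =>
    have hk : Commute (D.t ^ k) g := Commute.pow_left ht k
    rw [mul_assoc, hk.eq, ← mul_assoc, hi, mul_assoc]

/-! ### Remainders -/

lemma modr_spec (D : DiffPolyRing K δ R) {f : R} {m : ℕ} (hf : D.deg f = m) (x : R) :
    (∃ q, x = q * f + D.modr f x) ∧ D.modr f x ∈ D.res m := by
  have h := D.rightDiv f x (D.ne_zero_of_deg_eq hf)
  have hs := h.choose_spec.1
  rw [modr, dif_pos h]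
  exact ⟨hs.1, show D.deg _ < _ from hf ▸ hs.2⟩

lemma modr_unique (D : DiffPolyRing K δ R) {f : R} {m : ℕ} (hf : D.deg f = m) {x r q : R}
    (h : x = q * f + r) (hr : r ∈ D.res m) : D.modr f x = r := by
  obtain ⟨s, -, hs⟩ := D.rightDiv f x (D.ne_zero_of_deg_eq hf)
  have hmod := D.modr_spec hf x
  rw [hs _ ⟨hmod.1, show D.deg _ < D.deg f from hf ▸ hmod.2⟩,
    hs r ⟨⟨q, h⟩, show D.deg r < D.deg f from hf ▸ hr⟩]

lemma modr_eq_self (D : DiffPolyRing K δ R) {f : R} {m : ℕ} (hf : D.deg f = m) {x : R}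
    (hx : x ∈ D.res m) : D.modr f x = x :=
  D.modr_unique hf (q := 0) (by simp) hx

lemma modr_eq_modr_iff (D : DiffPolyRing K δ R) {f : R} {m : ℕ} (hf : D.deg f = m) {x y : R} :
    D.modr f x = D.modr f y ↔ ∃ q, x - y = q * f := by
  obtain ⟨⟨q, hq⟩, hr⟩ := D.modr_spec hf x
  obtain ⟨⟨q', hq'⟩, hr'⟩ := D.modr_spec hf y
  constructor
  · intro h
    refine ⟨q - q', ?_⟩
    conv_lhs => rw [hq, hq', h]
    rw [sub_mul]
    abel
  · rintro ⟨s, hs⟩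
    refine D.modr_unique hf (q := s + q') ?_ hr'
    rw [add_mul, add_assoc, ← hq', ← hs]
    abel

lemma modr_eq_zero_iff (D : DiffPolyRing K δ R) {f : R} {m : ℕ} (hf : D.deg f = m) {x : R} :
    D.modr f x = 0 ↔ ∃ q, x = q * f := by
  have h := D.modr_eq_modr_iff hf (x := x) (y := 0)
  rwa [D.modr_eq_self hf (D.res m).zero_mem, sub_zero] at h

lemma modr_add (D : DiffPolyRing K δ R) {f : R} {m : ℕ} (hf : D.deg f = m) (x y : R) :
    D.modr f (x + y) = D.modr f x + D.modr f y := by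
  obtain ⟨⟨q, hq⟩, hr⟩ := D.modr_spec hf x
  obtain ⟨⟨q', hq'⟩, hr'⟩ := D.modr_spec hf y
  refine D.modr_unique hf (q := q + q') ?_ ((D.res m).add_mem hr hr')
  conv_lhs => rw [hq, hq']
  rw [add_mul]
  abel

lemma modr_i_mul (D : DiffPolyRing K δ R) {f : R} {m : ℕ} (hf : D.deg f = m) (a : K) (x : R) :
    D.modr f (D.i a * x) = D.i a * D.modr f x := by
  obtain ⟨⟨q, hq⟩, hr⟩ := D.modr_spec hf x
  refine D.modr_unique hf (q := D.i a * q) ?_ (D.deg_i_mul_lt a hr)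
  conv_lhs => rw [hq]
  rw [mul_add, mul_assoc]

lemma one_mem_res (D : DiffPolyRing K δ R) {m : ℕ} (hm : 1 ≤ m) : (1 : R) ∈ D.res m := by
  rw [← map_one D.i]
  exact D.res_mono hm (D.i_mem_res_one 1)

lemma t_pow_mem_res (D : DiffPolyRing K δ R) (n : ℕ) : D.t ^ n ∈ D.res (n + 1) := by
  have h := D.coeff_monomial 1 n
  rw [map_one, one_mul] at h
  refine D.mem_res_iff.2 fun k hk => ?_
  rw [h, Finsupp.single_apply, if_neg (by omega)]

lemma one_ne_zero' (D : DiffPolyRing K δ R) : (1 : R) ≠ 0 := by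
  intro h
  have := D.coeff_i 1
  rw [map_one, h, D.coeff_zero] at this
  simpa using (DFunLike.congr_fun this 0).symm

lemma not_isUnit (D : DiffPolyRing K δ R) {f : R} {m : ℕ} (hm : 1 ≤ m) (hf : D.deg f = m) :
    ¬ IsUnit f := by
  rintro ⟨u, rfl⟩
  have := D.modr_eq_zero_iff hf (x := 1) |>.2 ⟨↑u⁻¹, by simp⟩
  rw [D.modr_eq_self hf (D.one_mem_res hm)] at this
  exact D.one_ne_zero' this

/-- The right nucleus is the set of reduced elements of the idealizer of `Rf`. -/
lemma mem_nucr_iff (D : DiffPolyRing K δ R) {f : R} {m : ℕ} (hm : 2 ≤ m) (hf : D.deg f = m)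
    {x : R} : x ∈ D.nucr f m ↔ x ∈ D.res m ∧ ∃ q, f * x = q * f := by
  have key : ∀ y z q r : R, y * z = q * f + r → r ∈ D.res m →
      (D.pmul f (D.pmul f y z) x = D.pmul f y (D.pmul f z x) ↔ ∃ s, q * (f * x) = s * f) := by
    intro y z q r hq hr
    obtain ⟨⟨q', hq'⟩, -⟩ := D.modr_spec hf (z * x)
    rw [pmul, pmul, pmul, pmul, D.modr_unique hf hq hr, D.modr_eq_modr_iff hf]
    have hrx : r * x = y * (z * x) - q * (f * x) := by
      rw [← mul_assoc y, hq]
      noncomm_ring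
    have e : r * x - y * D.modr f (z * x) = y * q' * f - q * (f * x) := by
      have : y * (z * x) = y * q' * f + y * D.modr f (z * x) := by
        conv_lhs => rw [hq']
        noncomm_ring
      rw [hrx, this]
      abel
    rw [e]
    constructor
    · rintro ⟨s, hs⟩
      exact ⟨y * q' - s, by rw [sub_mul, ← hs]; abel⟩
    · rintro ⟨s, hs⟩
      exact ⟨y * q' - s, by rw [sub_mul, hs]⟩
  constructor
  · rintro ⟨hx, h⟩
    refine ⟨hx, ?_⟩
    have hc := (D.deg_eq_iff.1 hf).2
    set c := (D.coeff f m)⁻¹ with hcdef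
    have hmm : D.t * D.t ^ (m - 1) = D.t ^ m := by rw [← pow_succ']; congr 1; omega
    have hmem : D.t ^ m - D.i c * f ∈ D.res m := by
      refine D.mem_res_of_coeff_eq_zero ((D.res _).sub_mem (D.t_pow_mem_res m)
        (D.deg_i_mul_lt _ (D.deg_eq_iff.1 hf).1)) ?_
      have ht := D.coeff_monomial 1 m
      rw [map_one, one_mul] at ht
      rw [D.coeff_sub, ht, D.coeff_smul]
      simp [hcdef, hc]
    obtain ⟨s, hs⟩ := (key D.t (D.t ^ (m - 1)) (D.i c) _
      (by rw [hmm]; abel) hmem).1 (h _ (D.res_mono hm (by simpa using D.t_pow_mem_res 1)) _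
        (D.res_mono (by omega) (D.t_pow_mem_res (m - 1))))
    refine ⟨D.i (D.coeff f m) * s, ?_⟩
    rw [mul_assoc, ← hs, ← mul_assoc, ← map_mul, hcdef, mul_inv_cancel₀ hc, map_one, one_mul]
  · rintro ⟨hx, q, hq⟩
    refine ⟨hx, fun y _ z _ => ?_⟩
    obtain ⟨⟨q', hq'⟩, hr⟩ := D.modr_spec hf (y * z)
    exact (key y z q' _ hq' hr).2 ⟨q' * q, by rw [hq, mul_assoc]⟩

/-! ### The `F`-structure -/

variable {F : Type} [Field F] [Algebra F K]

lemma i_algebraMap_comm (D : DiffPolyRing K δ R) (hconst : δ.HasConstants F) (c : F) (x : R) :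
    D.i (algebraMap F K c) * x = x * D.i (algebraMap F K c) := by
  have ht : Commute D.t (D.i (algebraMap F K c)) := by
    change D.t * _ = _
    rw [D.t_mul, (hconst _).2 ⟨c, rfl⟩, map_zero, add_zero]
  induction x using D.induction_monomial with
  | zero => simp
  | add x y hx hy => rw [add_mul, mul_add, hx, hy]
  | mono a n =>
    rw [mul_assoc, (ht.pow_left n).eq, ← mul_assoc, ← mul_assoc, ← map_mul, ← map_mul, mul_comm]

/-- The coordinates of a differential polynomial of degree `< n`. -/
def resEquiv (D : DiffPolyRing K δ R) (F : Type) [Field F] [Algebra F K] (n : ℕ) :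
    D.Rlt n ≃ₗ[F] (Fin n → K) where
  toFun x j := D.coeff x j
  map_add' x y := by
    funext j
    simp [D.coeff_add]
  map_smul' c x := by
    funext j
    simp [D.smul_coe, D.coeff_smul, Algebra.smul_def]
  invFun v := ⟨∑ j, D.i (v j) * D.t ^ (j : ℕ), (D.res n).sum_mem fun j _ =>
    D.deg_i_mul_lt _ (D.res_mono j.2 (D.t_pow_mem_res j))⟩
  left_inv x := by
    refine Subtype.ext ?_
    change ∑ j : Fin n, D.i (D.coeff x j) * D.t ^ (j : ℕ) = (x : R)
    conv_rhs => rw [D.repr' x]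
    rw [Fin.sum_univ_eq_sum_range (fun j => D.i (D.coeff x j) * D.t ^ j) n]
    rw [eq_comm]
    refine Finsupp.sum_of_support_subset _ (fun k hk => ?_) (fun j a => D.i a * D.t ^ j)
      fun _ _ => by rw [map_zero, zero_mul]
    by_contra h
    exact Finsupp.mem_support_iff.1 hk
      (D.mem_res_iff.1 x.2 k (by simpa using h))
  right_inv v := by
    funext j
    change D.coeff (∑ j : Fin n, D.i (v j) * D.t ^ (j : ℕ)) j = v j
    have hsum : D.coeff (∑ j : Fin n, D.i (v j) * D.t ^ (j : ℕ)) =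
        ∑ j : Fin n, Finsupp.single (j : ℕ) (v j) :=
      (map_sum (AddMonoidHom.mk' D.coeff D.coeff_add) _ _).trans
        (Finset.sum_congr rfl fun k _ => D.coeff_monomial _ _)
    rw [hsum, Finsupp.finsetSum_apply, Finset.sum_eq_single j]
    · simp
    · intro k _ hk
      rw [Finsupp.single_apply, if_neg (fun h => hk (Fin.ext h))]
    · simp

lemma finrank_Rlt (D : DiffPolyRing K δ R) [Module.Finite F K] (n : ℕ) :
    Module.finrank F (D.Rlt n) = n * Module.finrank F K := by
  rw [(D.resEquiv F n).finrank_eq, Module.finrank_pi_fintype]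
  simp

lemma finite_Rlt (D : DiffPolyRing K δ R) [Module.Finite F K] (n : ℕ) :
    Module.Finite F (D.Rlt n) :=
  Module.Finite.equiv (D.resEquiv F n).symm

/-- Right multiplication by `a` modulo `f`, as a map from polynomials of degree `< d` to `S_f`. -/
noncomputable def mulRightMod (D : DiffPolyRing K δ R) (F : Type) [Field F] [Algebra F K]
    {f : R} {m : ℕ} (hf : D.deg f = m) (d : ℕ) (a : R) : D.Rlt d →ₗ[F] D.Rlt m where
  toFun x := ⟨D.pmul f x a, (D.modr_spec hf _).2⟩
  map_add' x y := Subtype.ext <| by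
    change D.modr f ((x + y : R) * a) = D.modr f (x * a) + D.modr f (y * a)
    rw [add_mul, D.modr_add hf]
  map_smul' c x := Subtype.ext <| by
    change D.modr f (D.i (algebraMap F K c) * x * a) = D.i (algebraMap F K c) * D.modr f (x * a)
    rw [mul_assoc, D.modr_i_mul hf]

/-- Left multiplication by `a` modulo `f` on `S_f`. -/
noncomputable def mulLeftMod (D : DiffPolyRing K δ R) (hconst : δ.HasConstants F)
    {f : R} {m : ℕ} (hf : D.deg f = m) (a : R) : D.Rlt m →ₗ[F] D.Rlt m where
  toFun x := ⟨D.pmul f a x, (D.modr_spec hf _).2⟩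
  map_add' x y := Subtype.ext <| by
    change D.modr f (a * (x + y : R)) = D.modr f (a * x) + D.modr f (a * y)
    rw [mul_add, D.modr_add hf]
  map_smul' c x := Subtype.ext <| by
    change D.modr f (a * (D.i (algebraMap F K c) * x)) =
      D.i (algebraMap F K c) * D.modr f (a * x)
    rw [← mul_assoc, ← D.i_algebraMap_comm hconst, mul_assoc, D.modr_i_mul hf]

/-! ### Irreducible polynomials -/

lemma Irred.span_eq_top {D : DiffPolyRing K δ R} {f : R} {m : ℕ} (hf : D.deg f = m)
    (hirr : D.Irred f) {a : R} (ha : a ∈ D.res m) (ha0 : a ≠ 0) : Ideal.span {a, f} = ⊤ := by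
  have haJ : a ∈ Ideal.span {a, f} := Ideal.subset_span (by simp)
  have hfJ : f ∈ Ideal.span {a, f} := Ideal.subset_span (by simp)
  obtain ⟨g, hgJ, n, hn, hone, hmin⟩ := D.exists_monic_minimal (J := Ideal.span {a, f})
    (fun h => ha0 (by simpa [h] using haJ))
  obtain ⟨h, hh⟩ := D.exists_eq_mul_of_minimal hgJ hn hmin hfJ
  have hnm : n < m := by
    by_contra hle
    exact ha0 (hmin a haJ (D.res_mono (not_lt.1 hle) ha))
  have hh0 : h ≠ 0 := by
    rintro rfl
    exact D.ne_zero_of_deg_eq hf (by rw [hh, zero_mul])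
  obtain ⟨k, hk⟩ := D.exists_deg_eq hh0
  have hkn : m = k + n := WithBot.coe_injective
    (hf.symm.trans (by rw [hh, D.deg_mul hk hn]; rfl))
  have hmk : ¬ k < m := fun hlt => hirr.2 ⟨h, g, hh, by
    rw [hf, hk]; exact WithBot.coe_lt_coe.2 hlt, by rw [hf, hn]; exact WithBot.coe_lt_coe.2 hnm⟩
  obtain rfl : n = 0 := by omega
  have hg1 := D.eq_i_of_mem_res_one (D.deg_eq_iff.1 hn).1
  rw [hone, map_one] at hg1
  exact (Ideal.eq_top_iff_one _).2 (hg1 ▸ hgJ)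

lemma Irred.pmul_ne_zero {D : DiffPolyRing K δ R} {f : R} {m : ℕ} (hf : D.deg f = m)
    (hirr : D.Irred f) [Module.Finite F K] {x a : R} (hx : x ∈ D.res m)
    (hx0 : x ≠ 0) (ha : a ∈ D.res m) (ha0 : a ≠ 0) : D.pmul f x a ≠ 0 := by
  intro h
  obtain ⟨q, hq⟩ := (D.modr_eq_zero_iff hf).1 h
  obtain ⟨d, hd⟩ := D.exists_deg_eq hx0
  have hdm : d < m := WithBot.coe_lt_coe.1 (hd ▸ hx : (d : WithBot ℕ) < m)
  have hsurj : Function.Surjective (D.mulRightMod F hf d a) := by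
    intro y
    have hy : (y : R) ∈ Ideal.span {a, f} := by
      rw [hirr.span_eq_top hf ha ha0]
      trivial
    obtain ⟨u, v, huv⟩ := Ideal.mem_span_pair.1 hy
    obtain ⟨⟨w, hw⟩, hr⟩ := D.modr_spec hd u
    refine ⟨⟨_, hr⟩, Subtype.ext ?_⟩
    change D.modr f (D.modr x u * a) = y
    refine D.modr_unique hf (q := -(w * q) - v) ?_ y.2
    rw [← huv]
    conv_rhs => rw [hw]
    have : w * x * a = w * q * f := by rw [mul_assoc, hq, mul_assoc]
    rw [add_mul, this, sub_mul, neg_mul]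
    abel
  have := D.finite_Rlt (F := F) d
  have hle := LinearMap.finrank_le_finrank_of_surjective hsurj
  rw [D.finrank_Rlt, D.finrank_Rlt] at hle
  exact absurd (Nat.le_of_mul_le_mul_right hle Module.finrank_pos) (not_le.2 hdm)

lemma Irred.isDivisionPetit {D : DiffPolyRing K δ R} {f : R} {m : ℕ} (hm : 1 ≤ m)
    (hf : D.deg f = m) (hirr : D.Irred f) [Module.Finite F K] (hconst : δ.HasConstants F) :
    D.IsDivisionPetit f m := by
  have bij : ∀ L : D.Rlt m →ₗ[F] D.Rlt m, (∀ x, L x = 0 → x = 0) →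
      ∀ l : R → R, (∀ x : D.Rlt m, (L x : R) = l x) → Set.BijOn l (D.SfSet m) (D.SfSet m) := by
    intro L hL l hl
    have := D.finite_Rlt (F := F) m
    have hinj : Function.Injective L := (injective_iff_map_eq_zero L).2 hL
    have hsurj := LinearMap.injective_iff_surjective.1 hinj
    refine ⟨fun x hx => hl ⟨x, hx⟩ ▸ (L ⟨x, hx⟩).2, fun x hx y hy hxy => ?_, fun y hy => ?_⟩
    · have := hinj (a₁ := ⟨x, hx⟩) (a₂ := ⟨y, hy⟩) (Subtype.ext (by rw [hl, hl]; exact hxy))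
      exact congrArg Subtype.val this
    · obtain ⟨x, hx⟩ := hsurj ⟨y, hy⟩
      exact ⟨x, x.2, by rw [← hl, hx]⟩
  refine ⟨⟨1, D.one_mem_res hm, D.one_ne_zero'⟩, fun a ha ha0 => ⟨?_, ?_⟩⟩
  · refine bij (D.mulLeftMod hconst hf a) (fun x hx => ?_) _ fun x => rfl
    by_contra hx0
    exact hirr.pmul_ne_zero (F := F) hf ha ha0 x.2 (fun h => hx0 (Subtype.ext h))
      (congrArg Subtype.val hx)
  · refine bij (D.mulRightMod F hf m a) (fun x hx => ?_) _ fun x => rfl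
    by_contra hx0
    exact hirr.pmul_ne_zero (F := F) hf x.2 (fun h => hx0 (Subtype.ext h)) ha ha0
      (congrArg Subtype.val hx)

lemma IsDivisionPetit.irred {D : DiffPolyRing K δ R} {f : R} {m : ℕ} (hm : 1 ≤ m)
    (hf : D.deg f = m) (hdiv : D.IsDivisionPetit f m) : D.Irred f := by
  refine ⟨D.not_isUnit hm hf, ?_⟩
  rintro ⟨g, h, hgh, hg, hh⟩
  rw [hf] at hg hh
  have hf0 := D.ne_zero_of_deg_eq hf
  have hg0 : g ≠ 0 := by
    rintro rfl
    exact hf0 (by simpa using hgh)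
  have hh0 : h ≠ 0 := by
    rintro rfl
    exact hf0 (by simpa using hgh)
  refine hh0 ((hdiv.2 g hg hg0).1.injOn hh (D.res m).zero_mem ?_)
  change D.modr f (g * h) = D.modr f (g * 0)
  rw [D.modr_eq_modr_iff hf]
  exact ⟨1, by simp [hgh]⟩

end DiffPolyRing

namespace DiffPolyRing

variable {K : Type} [Field K] {δ : Der K} {R : Type} [Ring R]
variable {F : Type} [Field F] [Algebra F K]

/-! ### Semisimplicity of `R / Rf` -/

/-- A central element of `R` acts on `R / Rf` as a scalar if the right nucleus of `S_f` is
central over `F`. -/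
lemma exists_scalar_of_central (D : DiffPolyRing K δ R) {f : R} {m : ℕ} (hm : 2 ≤ m)
    (hf : D.deg f = m)
    (hcenter : ∀ a ∈ D.nucr f m, (∀ b ∈ D.nucr f m, D.pmul f a b = D.pmul f b a) →
      ∃ c : F, a = D.i (algebraMap F K c))
    {g : R} (hg : ∀ x, x * g = g * x) :
    ∃ c : F, ∃ q, g = q * f + D.i (algebraMap F K c) := by
  obtain ⟨⟨q, hq⟩, hr⟩ := D.modr_spec hf g
  have hr' : D.modr f g = g - q * f := by
    rw [eq_sub_iff_add_eq, add_comm]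
    exact hq.symm
  have hnuc : D.modr f g ∈ D.nucr f m := by
    refine (D.mem_nucr_iff hm hf).2 ⟨hr, g - f * q, ?_⟩
    rw [hr', mul_sub, hg, sub_mul, mul_assoc]
  obtain ⟨c, hc⟩ := hcenter _ hnuc fun b hb => by
    obtain ⟨-, s, hs⟩ := (D.mem_nucr_iff hm hf).1 hb
    rw [pmul, pmul, D.modr_eq_modr_iff hf]
    refine ⟨b * q - q * s, ?_⟩
    rw [hr', sub_mul, mul_sub, hg, mul_assoc q f b, hs]
    noncomm_ring
  exact ⟨c, q, hc ▸ hq⟩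

lemma isSemisimpleModule_quotient (D : DiffPolyRing K δ R) {f : R} {m : ℕ} (hm : 2 ≤ m)
    (hf : D.deg f = m) (hconst : δ.HasConstants F) [Module.Finite F K]
    (hcenter : ∀ a ∈ D.nucr f m, (∀ b ∈ D.nucr f m, D.pmul f a b = D.pmul f b a) →
      ∃ c : F, a = D.i (algebraMap F K c)) :
    IsSemisimpleModule R (R ⧸ Ideal.span {f}) := by
  let _ : Algebra F R := (D.i.comp (algebraMap F K)).toAlgebra' (D.i_algebraMap_comm hconst)
  have halg : ∀ c : F, algebraMap F R c = D.i (algebraMap F K c) := fun _ => rfl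
  have hfin : Module.Finite F (R ⧸ Ideal.span {f}) := by
    have := D.finite_Rlt (F := F) m
    let l : D.Rlt m →ₗ[F] R ⧸ Ideal.span {f} :=
      { toFun := fun x => Submodule.Quotient.mk (x : R)
        map_add' := fun _ _ => rfl
        map_smul' := fun c x => by
          rw [D.smul_coe, ← halg, ← Algebra.smul_def]
          rfl }
    refine Module.Finite.of_surjective l fun y => ?_
    obtain ⟨x, rfl⟩ := Submodule.Quotient.mk_surjective _ y
    obtain ⟨⟨q, hq⟩, hr⟩ := D.modr_spec hf x
    refine ⟨⟨_, hr⟩, ((Submodule.Quotient.eq _).2 ?_).symm⟩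
    exact Ideal.mem_span_singleton'.2 ⟨q, by rw [eq_sub_iff_add_eq]; exact hq.symm⟩
  let ρ : R →ₐ[F] Module.End F (R ⧸ Ideal.span {f}) := Algebra.lsmul F F _
  have hone : (1 : R) ∉ Ideal.span {f} := fun h => by
    have := (D.modr_eq_zero_iff hf).2 ((Ideal.mem_span_singleton'.1 h).imp fun _ => Eq.symm)
    rw [D.modr_eq_self hf (D.one_mem_res (by omega))] at this
    exact D.one_ne_zero' this
  have hnt : Nontrivial (R ⧸ Ideal.span {f}) :=
    ⟨Submodule.Quotient.mk 1, 0, fun h => hone ((Submodule.Quotient.mk_eq_zero _).1 h)⟩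
  have hart : IsArtinianRing ρ.range := IsArtinianRing.of_finite F ρ.range
  have hsurj : Function.Surjective ρ.rangeRestrict := ρ.rangeRestrict_surjective
  have hsimple : IsSimpleRing ρ.range := by
    refine IsSimpleRing.of_eq_bot_or_eq_top fun I => or_iff_not_imp_left.2 fun hI => ?_
    obtain ⟨y, hyI, hy⟩ : ∃ y ∈ I, y ≠ 0 := by
      by_contra! h
      exact hI (TwoSidedIdeal.ext fun x => ⟨fun hx => (TwoSidedIdeal.mem_bot _).2 (h x hx),
        fun hx => (TwoSidedIdeal.mem_bot _).1 hx ▸ I.zero_mem⟩)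
    let J : Ideal R :=
      { carrier := {x | ρ.rangeRestrict x ∈ I}
        add_mem' := fun {a b} ha hb => by
          change ρ.rangeRestrict (a + b) ∈ I
          rw [map_add]
          exact I.add_mem ha hb
        zero_mem' := by
          change ρ.rangeRestrict 0 ∈ I
          rw [map_zero]
          exact I.zero_mem
        smul_mem' := fun a x hx => by
          change ρ.rangeRestrict (a * x) ∈ I
          rw [map_mul]
          exact I.mul_mem_left _ _ hx }
    obtain ⟨x, rfl⟩ := hsurj y
    have hJ : J ≠ ⊥ := fun h => hy <| by
      have : x ∈ J := hyI
      rw [h, Submodule.mem_bot] at this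
      rw [this, map_zero]
    obtain ⟨g, hgJ, n, hn, hg1, hmin⟩ := D.exists_monic_minimal hJ
    have hcomm := D.commute_of_minimal (fun a ha b => by
      change ρ.rangeRestrict (a * b) ∈ I
      rw [map_mul]
      exact I.mul_mem_right _ _ ha) hgJ hn hg1 hmin
    obtain ⟨c, q, hc⟩ := D.exists_scalar_of_central hm hf hcenter hcomm
    have hρ : ρ.rangeRestrict g = algebraMap F _ c := by
      refine Subtype.ext (LinearMap.ext fun z => ?_)
      obtain ⟨z, rfl⟩ := Submodule.Quotient.mk_surjective _ z
      refine (Submodule.Quotient.eq _).2 (Ideal.mem_span_singleton'.2 ⟨z * q, ?_⟩)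
      change z * q * f = g * z - c • z
      rw [← hcomm, hc, Algebra.smul_def, halg, D.i_algebraMap_comm hconst]
      noncomm_ring
    have hc0 : c ≠ 0 := by
      rintro rfl
      obtain ⟨s, rfl⟩ := D.exists_eq_mul_of_minimal hgJ hn hmin (show x ∈ J from hyI)
      exact hy (by rw [map_mul, hρ, map_zero, mul_zero])
    refine I.eq_top ?_
    have hmem := I.mul_mem_left (algebraMap F _ c⁻¹) _ (show ρ.rangeRestrict g ∈ I from hgJ)
    rwa [hρ, ← map_mul, inv_mul_cancel₀ hc0, map_one] at hmem
  have hss : IsSemisimpleRing ρ.range :=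
    IsSimpleRing.isSemisimpleRing_iff_isArtinianRing.2 hart
  have : RingHomSurjective (ρ.rangeRestrict : R →+* ρ.range) := ⟨hsurj⟩
  let l : (R ⧸ Ideal.span {f}) →ₛₗ[(ρ.rangeRestrict : R →+* ρ.range)] (R ⧸ Ideal.span {f}) :=
    { toFun := id
      map_add' := fun _ _ => rfl
      map_smul' := fun _ _ => rfl }
  have hl : Function.Bijective l := Function.bijective_id
  exact (LinearMap.isSemisimpleModule_iff_of_bijective (R := R) (S := ρ.range)
    (σ := (ρ.rangeRestrict : R →+* ρ.range)) l hl).2 inferInstance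

/-- If `R / Rf` is semisimple and the right nucleus of `S_f` has only trivial idempotents, then
`f` is irreducible. -/
lemma irred_of_idempotents (D : DiffPolyRing K δ R) {f : R} {m : ℕ} (hm : 2 ≤ m)
    (hf : D.deg f = m) [IsSemisimpleModule R (R ⧸ Ideal.span {f})]
    (hidem : ∀ a ∈ D.nucr f m, D.pmul f a a = a → a = 0 ∨ a = 1) : D.Irred f := by
  refine ⟨D.not_isUnit (by omega) hf, ?_⟩
  rintro ⟨g, h, hgh, hg, hh⟩
  have hf0 := D.ne_zero_of_deg_eq hf
  have hg0 : g ≠ 0 := by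
    rintro rfl
    exact hf0 (by simpa using hgh)
  have hh0 : h ≠ 0 := by
    rintro rfl
    exact hf0 (by simpa using hgh)
  have hmk : ∀ x : R, (Submodule.Quotient.mk x : R ⧸ Ideal.span {f}) = 0 ↔ ∃ q, x = q * f :=
    fun x => (Submodule.Quotient.mk_eq_zero _).trans
      (Ideal.mem_span_singleton'.trans (exists_congr fun _ => eq_comm))
  have hsm : ∀ x y : R, (Submodule.Quotient.mk (x * y) : R ⧸ Ideal.span {f}) =
      x • Submodule.Quotient.mk y := fun _ _ => rfl
  obtain ⟨N', hN⟩ := exists_isCompl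
    (Submodule.span R {(Submodule.Quotient.mk h : R ⧸ Ideal.span {f})})
  set N := Submodule.span R {(Submodule.Quotient.mk h : R ⧸ Ideal.span {f})} with hNdef
  let e : (R ⧸ Ideal.span {f}) →ₗ[R] R ⧸ Ideal.span {f} :=
    N.subtype ∘ₗ N.projectionOnto N' hN
  have heN : ∀ z, e z ∈ N := fun z => (N.projectionOnto N' hN z).2
  have heq : ∀ z ∈ N, e z = z := fun z hz =>
    congrArg Subtype.val (Submodule.projectionOnto_apply_left hN ⟨z, hz⟩)
  have h1 : ∀ x : R, (Submodule.Quotient.mk x : R ⧸ Ideal.span {f}) =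
    x • Submodule.Quotient.mk 1 := fun x => by rw [← hsm, mul_one]
  obtain ⟨b, hb⟩ := Submodule.Quotient.mk_surjective _ (e (Submodule.Quotient.mk 1))
  obtain ⟨⟨q, hq⟩, ha⟩ := D.modr_spec hf b
  set a := D.modr f b with hadef
  have hea : e (Submodule.Quotient.mk 1) = Submodule.Quotient.mk a := by
    rw [← hb, hq, Submodule.Quotient.mk_add, (hmk (q * f)).2 ⟨q, rfl⟩, zero_add]
  have hex : ∀ x : R, e (Submodule.Quotient.mk x) = Submodule.Quotient.mk (x * a) := fun x => by
    rw [h1, map_smul, hea, hsm]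
  have hnuc : a ∈ D.nucr f m := by
    refine (D.mem_nucr_iff hm hf).2 ⟨ha, (hmk _).1 ?_⟩
    rw [← hex, (hmk f).2 ⟨1, by simp⟩, map_zero]
  have haa : D.pmul f a a = a := by
    have hz : (Submodule.Quotient.mk (a * a) : R ⧸ Ideal.span {f}) = Submodule.Quotient.mk a := by
      rw [← hex, ← hea, heq _ (heN _)]
    rw [Submodule.Quotient.eq, Ideal.mem_span_singleton'] at hz
    exact ((D.modr_eq_modr_iff hf).2 (hz.imp fun _ => Eq.symm)).trans (D.modr_eq_self hf ha)
  rcases hidem a hnuc haa with h0 | h0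
  · have hz := heq _ (Submodule.mem_span_singleton_self (R := R) (Submodule.Quotient.mk h))
    rw [hex, h0, mul_zero] at hz
    have := (D.modr_eq_zero_iff hf).2 ((hmk h).1 hz.symm)
    rw [D.modr_eq_self hf (show D.deg h < m from hf ▸ hh)] at this
    exact hh0 this
  · have hmem := heN (Submodule.Quotient.mk 1)
    rw [hea, h0, hNdef, Submodule.mem_span_singleton] at hmem
    obtain ⟨r, hr⟩ := hmem
    rw [← hsm, Submodule.Quotient.eq] at hr
    obtain ⟨s, hs⟩ := Ideal.mem_span_singleton'.1 hr
    have hunit : (1 : R) = (r - s * g) * h := by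
      rw [sub_mul, mul_assoc, ← hgh, hs]
      abel
    obtain ⟨n, hn⟩ := D.exists_deg_eq hh0
    obtain ⟨k, hk⟩ := D.exists_deg_eq hg0
    have hu0 : r - s * g ≠ 0 := by
      intro hu
      rw [hu, zero_mul] at hunit
      exact D.one_ne_zero' hunit
    obtain ⟨j, hj⟩ := D.exists_deg_eq hu0
    have hdeg1 : D.deg (1 : R) = (0 : ℕ) := D.deg_eq_iff.2
      ⟨D.one_mem_res le_rfl, by rw [← map_one D.i, D.coeff_i]; simp⟩
    have e1 : 0 = j + n := WithBot.coe_injective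
      (hdeg1.symm.trans ((congrArg D.deg hunit).trans (D.deg_mul hj hn)))
    obtain rfl : n = 0 := by omega
    have e2 := D.deg_mul hk hn
    rw [add_zero, ← hgh, ← hk] at e2
    exact hg.ne e2.symm

end DiffPolyRing

/-- With `K/F` purely inseparable of exponent one, `[K:F] = p^e`, and
`f ∈ K[t;δ]` of degree `m` with `2 ≤ m < p^e` such that `B = Nuc_r(S_f)` is a central
simple algebra of degree `m` over `F`: the following are equivalent: `f` is irreducible in
`K[t;δ]`; `B` is a division algebra; `S_f` is a division algebra. -/
theorem statement_8 (p : ℕ) [Fact p.Prime] (F K B : Type) [Field F] [CharP F p]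
    [Field K] [Algebra F K] [Ring B] [Algebra F B] (e : ℕ)
    (hpureinsep : ∀ z : K, z ^ p ∈ (algebraMap F K).range)
    (hdim : Module.finrank F K = p ^ e)
    (δ : Der K) (hconst : δ.HasConstants F)
    (R : Type) [Ring R] (D : DiffPolyRing K δ R) (f : R) (m : ℕ)
    (hm : 2 ≤ m) (hmlt : m < p ^ e) (hdeg : D.deg f = (m : WithBot ℕ))
    (hcentral : Algebra.IsCentral F B) (hsimple : IsSimpleRing B)
    (hdegB : Module.finrank F B = m ^ 2)
    (hpres : D.RightNucPresents F f m B) :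
    (D.Irred f ↔ (Nontrivial B ∧ ∀ z : B, z ≠ 0 → IsUnit z)) ∧
    (D.Irred f ↔ D.IsDivisionPetit f m) := by
  obtain ⟨φ, hadd, hmul, halg⟩ := hpres
  have hFK : Module.Finite F K := Module.finite_of_finrank_pos (by omega)
  have hFB : Module.Finite F B := Module.finite_of_finrank_pos (by rw [hdegB]; positivity)
  have hφ0 : (φ 0 : R) = 0 := by simpa using hadd 0 0
  have hφ1 : (φ 1 : R) = 1 := by simpa using halg 1
  have hφne : ∀ z : B, z ≠ 0 → (φ z : R) ≠ 0 := fun z hz h =>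
    hz (φ.injective (Subtype.ext (h.trans hφ0.symm)))
  refine ⟨⟨fun hirr => ⟨inferInstance, fun z hz => ?_⟩, fun ⟨_, hB⟩ => ?_⟩,
    fun hirr => hirr.isDivisionPetit (by omega) hdeg hconst, fun h => h.irred (by omega) hdeg⟩
  · have : NoZeroDivisors B := ⟨fun {x y} hxy => by
      by_contra! hne
      refine hirr.pmul_ne_zero (F := F) hdeg (φ x).2.1 (hφne x hne.1) (φ y).2.1 (hφne y hne.2) ?_
      rw [← hmul, hxy, hφ0]⟩
    have : IsDomain B := NoZeroDivisors.to_isDomain B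
    exact FiniteDimensional.isUnit F hz
  · have := D.isSemisimpleModule_quotient (F := F) hm hdeg hconst fun a ha hcomm => by
      have hmem : φ.symm ⟨a, ha⟩ ∈ Subalgebra.center F B := by
        refine Subalgebra.mem_center_iff.2 fun b => φ.injective (Subtype.ext ?_)
        rw [hmul, hmul, φ.apply_symm_apply]
        exact (hcomm _ (φ b).2).symm
      obtain ⟨c, hc⟩ := Algebra.mem_bot.1 (hcentral.out hmem)
      refine ⟨c, ?_⟩
      rw [← halg, hc, φ.apply_symm_apply]
    refine D.irred_of_idempotents hm hdeg fun a ha haa => ?_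
    obtain ⟨b, hb⟩ := φ.surjective ⟨a, ha⟩
    have hba : (φ b : R) = a := by rw [hb]
    have hbb : b * b = b := φ.injective (Subtype.ext (by rw [hmul, hba, haa]))
    rcases eq_or_ne b 0 with rfl | hb0
    · exact Or.inl (hba.symm.trans hφ0)
    · obtain rfl : b = 1 := (hB b hb0).mul_left_cancel (by rw [hbb, mul_one])
      exact Or.inr (hba.symm.trans hφ1)
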